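/- For n ≥ 0 and 0 ≤ j ≤ ⌊n/2⌋, define d_{n,j}(α) = γ_{n,j}(α)/2^j where γ_{n,j}(α) are the gamma-coefficients of the α-Eulerian polynomial. Then Σ_{j=0}^{⌊n/2⌋} d_{n,j}(α) x^j = Σ_{σ ∈ A_{n+1}^1} x^{des(σ)} α^{lmax(σ)−1}, where A_{n+1}^1 is the set of André permutations of the first kind of [n+1]. -/

import Mathlib

open Finset Polynomial
open scoped Classical
noncomputable section

def wrd {n : ℕ} (σ : Equiv.Perm (Fin n)) (i : ℕ) : ℕ :=
  if h : 1 ≤ i ∧ i ≤ n then ((σ ⟨i - 1, by omega⟩ : Fin n) : ℕ) + 1 else 0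

def permDes {n : ℕ} (σ : Equiv.Perm (Fin n)) : ℕ :=
  ((Finset.Icc 1 (n - 1)).filter fun i => wrd σ (i + 1) < wrd σ i).card

def permLmax {n : ℕ} (σ : Equiv.Perm (Fin n)) : ℕ :=
  ((Finset.Icc 1 n).filter fun i => ∀ j ∈ Finset.Ico 1 i, wrd σ j < wrd σ i).card

def permRmax {n : ℕ} (σ : Equiv.Perm (Fin n)) : ℕ :=
  ((Finset.Icc 1 n).filter fun i => ∀ j ∈ Finset.Icc (i + 1) n, wrd σ j < wrd σ i).card

/-- André words of the first kind (recursive definition): the empty word is André;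
a word w = v ++ m :: v' where m is smaller than every other letter is André if
v and v' are André and (when v is nonempty) some letter of v' exceeds all of v
(i.e. max(vv') occurs in v'). One-letter words are covered by v = v' = []. -/
inductive IsAndre1 : List ℕ → Prop
  | nil : IsAndre1 []
  | node (v v' : List ℕ) (m : ℕ)
      (hmin : ∀ a ∈ v ++ v', m < a)
      (hv : IsAndre1 v) (hv' : IsAndre1 v')
      (hmax : v = [] ∨ ∃ M ∈ v', ∀ a ∈ v, a < M) :
      IsAndre1 (v ++ m :: v')

/-- σ is an André permutation of the first kind. -/
def IsAndrePerm1 {n : ℕ} (σ : Equiv.Perm (Fin n)) : Prop :=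
  IsAndre1 (List.ofFn fun i : Fin n => ((σ i : Fin n) : ℕ) + 1)

/-- A_{n,k}(α) as a polynomial in α (the variable `X` of `ℚ[X]`). -/
def Apoly (n k : ℕ) : Polynomial ℚ :=
  ∑ σ ∈ Finset.univ.filter (fun σ : Equiv.Perm (Fin (n + 1)) => permDes σ = k),
    (Polynomial.X : Polynomial ℚ) ^ (permLmax σ + permRmax σ - 2)

theorem append_cons_inj_of_notMem {u v u' v' : List ℕ} {m : ℕ} (hu : m ∉ u) (hu' : m ∉ u')
    (h : u ++ m :: v = u' ++ m :: v') : u = u' ∧ v = v' := by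
  induction u generalizing u' with
  | nil =>
    cases u' with
    | nil => simpa using h
    | cons b u' =>
      simp only [List.nil_append, List.cons_append, List.cons.injEq] at h
      exact (hu' (h.1 ▸ List.mem_cons_self)).elim
  | cons a u ih =>
    cases u' with
    | nil =>
      simp only [List.nil_append, List.cons_append, List.cons.injEq] at h
      exact (hu (h.1 ▸ List.mem_cons_self)).elim
    | cons b u' =>
      simp only [List.cons_append, List.cons.injEq, List.mem_cons, not_or] at h hu hu'
      obtain ⟨rfl, h⟩ := h
      simpa using ih hu.2 hu'.2 h

theorem append_cons_inj_of_lt {u v u' v' : List ℕ} {m m' : ℕ} (h : ∀ a ∈ u ++ v, m < a)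
    (h' : ∀ a ∈ u' ++ v', m' < a) (e : u ++ m :: v = u' ++ m' :: v') :
    u = u' ∧ m = m' ∧ v = v' := by
  have hm : m = m' := by
    have h1 : m ∈ u' ++ m' :: v' := by rw [← e]; simp
    have h2 : m' ∈ u ++ m :: v := by rw [e]; simp
    simp only [List.mem_append, List.mem_cons] at h1 h2 h h'
    have := h m'
    have := h' m
    grind
  subst hm
  have := append_cons_inj_of_notMem (fun hu => (h m (by simp [hu])).false)
    (fun hu => (h' m (by simp [hu])).false) e
  exact ⟨this.1, rfl, this.2⟩

theorem List.Nodup.exists_min_split {l : List ℕ} (hl : l.Nodup) (hne : l ≠ []) :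
    ∃ v m v', l = v ++ m :: v' ∧ ∀ a ∈ v ++ v', m < a := by
  obtain ⟨m, hm, hmin⟩ := l.toFinset.exists_min_image id
    (by simpa [Finset.nonempty_iff_ne_empty] using hne)
  obtain ⟨v, v', rfl⟩ := List.append_of_mem (List.mem_toFinset.1 hm)
  refine ⟨v, m, v', rfl, fun a ha => lt_of_le_of_ne (hmin a ?_) ?_⟩
  · simp only [List.mem_append] at ha
    simp; tauto
  · rintro rfl
    rw [List.nodup_middle] at hl
    exact (List.nodup_cons.1 hl).1 ha

theorem isAndre1_split {v v' : List ℕ} {m : ℕ} (hmin : ∀ a ∈ v ++ v', m < a) :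
    IsAndre1 (v ++ m :: v') ↔
      IsAndre1 v ∧ IsAndre1 v' ∧ (v = [] ∨ ∃ M ∈ v', ∀ a ∈ v, a < M) := by
  refine ⟨fun h => ?_, fun ⟨h1, h2, h3⟩ => .node v v' m hmin h1 h2 h3⟩
  generalize hw : v ++ m :: v' = w at h
  cases h with
  | nil => simp at hw
  | node p p' k hk hp hp' hmax =>
    obtain ⟨rfl, rfl, rfl⟩ := append_cons_inj_of_lt hmin hk hw
    exact ⟨hp, hp', hmax⟩

theorem isAndre1_singleton (m : ℕ) : IsAndre1 [m] :=
  .node [] [] m (by simp) .nil .nil (.inl rfl)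

theorem IsAndre1.eq_nil_or_eq_append_max {w : List ℕ} (h : IsAndre1 w) :
    w = [] ∨ ∃ u K, w = u ++ [K] ∧ ∀ a ∈ u, a < K := by
  induction h with
  | nil => exact .inl rfl
  | node v v' m hmin _ _ hmax _ ih =>
    right
    rcases ih with rfl | ⟨u, K, rfl, hK⟩
    · obtain rfl : v = [] := by simpa using hmax
      exact ⟨[], m, by simp⟩
    · refine ⟨v ++ m :: u, K, by simp, ?_⟩
      simp only [List.mem_append, List.mem_cons, List.not_mem_nil, or_false] at *
      grind

theorem isAndre1_append_max_split {v v' : List ℕ} {m N : ℕ} (hmin : ∀ a ∈ v ++ v', m < a)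
    (hN : ∀ a ∈ v ++ m :: v', a < N) :
    IsAndre1 (v ++ m :: v' ++ [N]) ↔ IsAndre1 v ∧ IsAndre1 (v' ++ [N]) := by
  have : v ++ m :: v' ++ [N] = v ++ m :: (v' ++ [N]) := by simp
  rw [this, isAndre1_split]
  · refine and_congr_right fun _ => and_iff_left (.inr ⟨N, by simp, fun a ha => hN a (by simp [ha])⟩)
  · intro a ha
    have := hmin a
    have := hN m (by simp)
    simp only [List.mem_append, List.mem_singleton] at *
    grind

theorem IsAndre1.append_max_congr {w : List ℕ} {N N' : ℕ} (hw : w.Nodup) (hN : ∀ a ∈ w, a < N)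
    (hN' : ∀ a ∈ w, a < N') (h : IsAndre1 (w ++ [N])) : IsAndre1 (w ++ [N']) := by
  induction hn : w.length using Nat.strong_induction_on generalizing w with
  | _ n ih =>
    by_cases hne : w = []
    · subst hne; exact isAndre1_singleton N'
    · obtain ⟨v, m, v', rfl, hmin⟩ := hw.exists_min_split hne
      rw [isAndre1_append_max_split hmin hN] at h
      rw [isAndre1_append_max_split hmin hN']
      refine ⟨h.1, ih v'.length (by simp at hn; omega) ?_ (fun a ha => hN a (by simp [ha]))
        (fun a ha => hN' a (by simp [ha])) h.2 rfl⟩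
      rw [List.nodup_middle] at hw
      exact (List.nodup_append.1 (List.nodup_cons.1 hw).2).2.1

/-- A word that becomes an André word of the first kind once a letter larger than all of its
letters is appended. -/
def IsPreAndre1 (w : List ℕ) : Prop :=
  ∃ N, (∀ a ∈ w, a < N) ∧ IsAndre1 (w ++ [N])

theorem isPreAndre1_iff {w : List ℕ} {N : ℕ} (hw : w.Nodup) (hN : ∀ a ∈ w, a < N) :
    IsPreAndre1 w ↔ IsAndre1 (w ++ [N]) :=
  ⟨fun ⟨_, hM, h⟩ => h.append_max_congr hw hM hN, fun h => ⟨N, hN, h⟩⟩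

theorem isPreAndre1_nil : IsPreAndre1 [] := ⟨0, by simp, isAndre1_singleton 0⟩

theorem isPreAndre1_min_split {v v' : List ℕ} {m : ℕ} (hw : (v ++ m :: v').Nodup)
    (hmin : ∀ a ∈ v ++ v', m < a) :
    IsPreAndre1 (v ++ m :: v') ↔ IsAndre1 v ∧ IsPreAndre1 v' := by
  obtain ⟨N, hN⟩ : ∃ N, ∀ a ∈ v ++ m :: v', a < N :=
    ⟨(v ++ m :: v').sum + 1, fun a ha => Nat.lt_succ_of_le (List.le_sum_of_mem ha)⟩
  rw [isPreAndre1_iff hw hN, isAndre1_append_max_split hmin hN, isPreAndre1_iff]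
  · rw [List.nodup_middle] at hw
    exact (List.nodup_append.1 (List.nodup_cons.1 hw).2).2.1
  · exact fun a ha => hN a (by simp [ha])

theorem isAndre1_max_split {u p : List ℕ} {M : ℕ} (hw : (u ++ M :: p).Nodup)
    (hmax : ∀ a ∈ u ++ p, a < M) : IsAndre1 (u ++ M :: p) ↔ p = [] ∧ IsPreAndre1 u := by
  have hu : u.Nodup := (List.nodup_append.1 hw).1
  constructor
  · intro h
    have hp : p = [] := by
      rcases h.eq_nil_or_eq_append_max with h0 | ⟨v, K, e, hK⟩
      · simp at h0
      rcases List.eq_nil_or_concat p with rfl | ⟨q, k, rfl⟩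
      · rfl
      · have e' : (u ++ M :: q) ++ [k] = v ++ [K] := by simpa using e
        obtain ⟨rfl, hk⟩ := List.append_inj' e' rfl
        obtain rfl : k = K := by simpa using hk
        exact absurd (hmax k (by simp)) (hK M (by simp)).le.not_gt
    subst hp
    exact ⟨rfl, (isPreAndre1_iff hu fun a ha => hmax a (by simp [ha])).2 h⟩
  · rintro ⟨rfl, h⟩
    exact (isPreAndre1_iff hu fun a ha => hmax a (by simp [ha])).1 h

/-- A word that is empty, or starts with its smallest letter, the remaining letters forming a
pre-André word. -/
def IsAndreTail (v : List ℕ) : Prop :=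
  v = [] ∨ ∃ m v', v = m :: v' ∧ (∀ a ∈ v', m < a) ∧ IsPreAndre1 v'

theorem isAndreTail_min_split {p q : List ℕ} {m : ℕ} (hmin : ∀ a ∈ p ++ q, m < a) :
    IsAndreTail (p ++ m :: q) ↔ p = [] ∧ IsPreAndre1 q := by
  constructor
  · rintro (h | ⟨k, v', e, hk, h⟩)
    · simp at h
    · obtain ⟨rfl, rfl, rfl⟩ :=
        append_cons_inj_of_lt (u' := []) hmin (by simpa using hk) (by simpa using e)
      exact ⟨rfl, h⟩
  · rintro ⟨rfl, h⟩
    exact .inr ⟨m, q, rfl, by simpa using hmin, h⟩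

theorem isPreAndre1_max_split {u v : List ℕ} {M : ℕ} (hw : (u ++ M :: v).Nodup)
    (hmax : ∀ a ∈ u ++ v, a < M) :
    IsPreAndre1 (u ++ M :: v) ↔ IsPreAndre1 u ∧ IsAndreTail v := by
  induction hn : u.length using Nat.strong_induction_on generalizing u with
  | _ n ih =>
    obtain ⟨p, m, q, e, hmin⟩ := hw.exists_min_split (by simp)
    rw [List.append_eq_append_iff] at e
    rcases e with ⟨s, rfl, e⟩ | ⟨s, rfl, e⟩
    · rcases s with _ | ⟨b, s⟩
      · simp only [List.nil_append, List.cons.injEq] at e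
        obtain ⟨rfl, rfl⟩ := e
        have h0 : u = [] ∧ v = [] := by
          constructor <;>
          · rw [List.eq_nil_iff_forall_not_mem]
            intro a ha
            exact (hmin a (by simp [ha])).not_gt (hmax a (by simp [ha]))
        obtain ⟨rfl, rfl⟩ := h0
        simp only [IsAndreTail, true_or, and_true, List.nil_append, isPreAndre1_nil, iff_true]
        exact (isPreAndre1_min_split (v := []) (by simp) (by simp)).2 ⟨.nil, isPreAndre1_nil⟩
      · simp only [List.cons_append, List.cons.injEq] at e
        obtain ⟨rfl, rfl⟩ := e
        have e2 : u ++ M :: (s ++ m :: q) = (u ++ M :: s) ++ m :: q := by simp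
        rw [e2] at hw ⊢
        rw [isPreAndre1_min_split hw hmin,
          isAndre1_max_split (List.nodup_append.1 hw).1, isAndreTail_min_split]
        · tauto
        · exact fun a ha => hmin a (by simp at ha ⊢; tauto)
        · exact fun a ha => hmax a (by simp at ha ⊢; tauto)
    · rcases s with _ | ⟨b, s⟩
      · simp only [List.nil_append, List.cons.injEq, List.append_nil] at *
        obtain ⟨rfl, rfl⟩ := e
        have h0 : p = [] ∧ q = [] := by
          constructor <;>
          · rw [List.eq_nil_iff_forall_not_mem]
            intro a ha
            exact (hmin a (by simp [ha])).not_gt (hmax a (by simp [ha]))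
        obtain ⟨rfl, rfl⟩ := h0
        simp only [IsAndreTail, true_or, and_true, List.nil_append, isPreAndre1_nil, iff_true]
        exact (isPreAndre1_min_split (v := []) (by simp) (by simp)).2 ⟨.nil, isPreAndre1_nil⟩
      · simp only [List.cons_append, List.cons.injEq] at e
        obtain ⟨rfl, rfl⟩ := e
        have e2 : p ++ m :: s ++ M :: v = p ++ m :: (s ++ M :: v) := by simp
        have hu : (p ++ m :: s).Nodup := (List.nodup_append.1 hw).1
        rw [e2] at hw ⊢
        have hs : (s ++ M :: v).Nodup := by
          rw [List.nodup_middle] at hw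
          exact (List.nodup_append.1 (List.nodup_cons.1 hw).2).2.1
        rw [isPreAndre1_min_split hw hmin, isPreAndre1_min_split hu,
          ih s.length (by simp at hn; omega) hs (fun a ha => hmax a (by simp at ha ⊢; tauto)) rfl]
        · tauto
        · exact fun a ha => hmin a (by simp at ha ⊢; tauto)

/-- The words using every letter of `S` exactly once. -/
def wordsOn (S : Finset ℕ) : Finset (List ℕ) := ⟨S.val.lists, Multiset.lists_nodup_finset S⟩

theorem mem_wordsOn {S : Finset ℕ} {l : List ℕ} :
    l ∈ wordsOn S ↔ l.Nodup ∧ l.toFinset = S := by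
  rw [wordsOn, Finset.mem_mk, Multiset.mem_lists_iff]
  constructor
  · intro h
    have hl : l.Nodup := by
      have := S.nodup
      rw [h] at this
      exact Multiset.coe_nodup.1 this
    refine ⟨hl, ?_⟩
    ext a
    rw [List.mem_toFinset, ← Finset.mem_val, h]
    rfl
  · rintro ⟨hl, rfl⟩
    rw [List.toFinset_val, hl.dedup]
    rfl

theorem mem_of_mem_wordsOn {S : Finset ℕ} {l : List ℕ} (h : l ∈ wordsOn S) {a : ℕ} :
    a ∈ l ↔ a ∈ S := by
  rw [← (mem_wordsOn.1 h).2, List.mem_toFinset]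

theorem wordsOn_empty : wordsOn ∅ = {[]} := by
  ext l
  rw [mem_wordsOn, Finset.mem_singleton, List.toFinset_eq_empty_iff]
  constructor
  · exact fun h => h.2
  · rintro rfl; simp

theorem append_cons_mem_wordsOn {S T : Finset ℕ} {m : ℕ} {u v : List ℕ} (hm : m ∉ S) (hT : T ⊆ S)
    (hu : u ∈ wordsOn T) (hv : v ∈ wordsOn (S \ T)) : u ++ m :: v ∈ wordsOn (insert m S) := by
  rw [mem_wordsOn] at *
  obtain ⟨hu, rfl⟩ := hu
  obtain ⟨hv, hvS⟩ := hv
  have hv' : ∀ a, a ∈ v ↔ a ∈ S ∧ a ∉ u := fun a => by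
    rw [← List.mem_toFinset, hvS]; simp
  have hu' : ∀ a ∈ u, a ∈ S := fun a ha => hT (by simpa using ha)
  refine ⟨?_, ?_⟩
  · rw [List.nodup_middle, List.nodup_cons, List.nodup_append]
    refine ⟨fun h => hm ?_, hu, hv, ?_⟩
    · rcases List.mem_append.1 h with h | h
      · exact hu' m h
      · exact ((hv' m).1 h).1
    · rintro a ha b hb rfl
      exact ((hv' a).1 hb).2 ha
  · ext a
    have := hv' a
    have := hu' a
    simp only [List.mem_toFinset, List.mem_append, List.mem_cons, Finset.mem_insert]
    tauto

theorem sum_wordsOn_insert {A : Type*} [AddCommMonoid A] {S : Finset ℕ} {m : ℕ} (hm : m ∉ S)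
    (f : List ℕ → A) :
    ∑ w ∈ wordsOn (insert m S), f w =
      ∑ T ∈ S.powerset, ∑ u ∈ wordsOn T, ∑ v ∈ wordsOn (S \ T), f (u ++ m :: v) := by
  simp_rw [← Finset.sum_product', Finset.sum_sigma']
  symm
  refine Finset.sum_nbij (fun p => p.2.1 ++ m :: p.2.2) ?_ ?_ ?_ (fun _ _ => rfl)
  · rintro ⟨T, u, v⟩ h
    simp only [Finset.mem_sigma, Finset.mem_powerset, Finset.mem_product] at h
    exact append_cons_mem_wordsOn hm h.1 h.2.1 h.2.2
  · rintro ⟨T, u, v⟩ h ⟨T', u', v'⟩ h' e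
    simp only [Finset.coe_sigma, Set.mem_sigma_iff, Finset.mem_coe, Finset.mem_powerset,
      Finset.mem_product] at h h'
    obtain ⟨rfl, rfl⟩ := append_cons_inj_of_notMem
      (fun hu => hm (h.1 ((mem_of_mem_wordsOn h.2.1).1 hu)))
      (fun hu => hm (h'.1 ((mem_of_mem_wordsOn h'.2.1).1 hu))) e
    obtain rfl : T = T' := by
      rw [← (mem_wordsOn.1 h.2.1).2, ← (mem_wordsOn.1 h'.2.1).2]
    rfl
  · intro w hw
    obtain ⟨u, v, rfl⟩ := List.append_of_mem ((mem_of_mem_wordsOn hw (a := m)).2 (by simp))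
    have hw' : (u ++ m :: v).Nodup ∧ _ := mem_wordsOn.1 hw
    have hnd := hw'.1
    rw [List.nodup_middle, List.nodup_cons, List.nodup_append, List.mem_append, not_or] at hnd
    obtain ⟨⟨hmu, hmv⟩, hu, hv, huv⟩ := hnd
    have hS : ∀ a, a ∈ S ↔ a ∈ u ∨ a ∈ v := fun a => by
      have := mem_of_mem_wordsOn hw (a := a)
      simp only [List.mem_append, List.mem_cons, Finset.mem_insert] at this
      by_cases ha : a = m
      · subst ha; tauto
      · tauto
    refine ⟨⟨u.toFinset, u, v⟩, ?_, rfl⟩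
    simp only [Finset.coe_sigma, Set.mem_sigma_iff, Finset.mem_coe, Finset.mem_powerset,
      Finset.mem_product, mem_wordsOn]
    refine ⟨fun a ha => (hS a).2 (.inl (by simpa using ha)), ⟨hu, trivial⟩, hv, ?_⟩
    ext a
    rw [Finset.mem_sdiff, hS, List.mem_toFinset, List.mem_toFinset]
    have := fun ha hb => huv a ha a hb rfl
    tauto

/-- The subset convolution of two functions on finite sets. -/
def subsetConv {R : Type*} [CommRing R] (f g : Finset ℕ → R) (S : Finset ℕ) : R :=
  ∑ T ∈ S.powerset, f T * g (S \ T)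

theorem subsetConv_comm {R : Type*} [CommRing R] (f g : Finset ℕ → R) :
    subsetConv f g = subsetConv g f := by
  funext S
  refine Finset.sum_bij' (fun T _ => S \ T) (fun T _ => S \ T) ?_ ?_ ?_ ?_ ?_ <;>
    simp only [Finset.mem_powerset, Finset.sdiff_subset, implies_true]
  · exact fun T hT => Finset.sdiff_sdiff_eq_self hT
  · exact fun T hT => Finset.sdiff_sdiff_eq_self hT
  · intro T hT
    rw [Finset.sdiff_sdiff_eq_self hT, mul_comm]

theorem subsetConv_assoc {R : Type*} [CommRing R] (f g h : Finset ℕ → R) :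
    subsetConv (subsetConv f g) h = subsetConv f (subsetConv g h) := by
  funext S
  simp only [subsetConv, Finset.sum_mul, Finset.mul_sum]
  rw [Finset.sum_sigma', Finset.sum_sigma']
  refine Finset.sum_bij' (fun p _ => ⟨p.2, p.1 \ p.2⟩) (fun p _ => ⟨p.1 ∪ p.2, p.1⟩) ?_ ?_ ?_ ?_ ?_
  · rintro ⟨T, U⟩ h
    simp only [Finset.mem_sigma, Finset.mem_powerset] at h ⊢
    exact ⟨h.2.trans h.1, Finset.sdiff_subset_sdiff h.1 subset_rfl⟩
  · rintro ⟨U, V⟩ h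
    simp only [Finset.mem_sigma, Finset.mem_powerset] at h ⊢
    exact ⟨Finset.union_subset h.1 (h.2.trans Finset.sdiff_subset), Finset.subset_union_left⟩
  · rintro ⟨T, U⟩ h
    simp only [Finset.mem_sigma, Finset.mem_powerset] at h ⊢
    rw [Finset.union_sdiff_of_subset h.2]
  · rintro ⟨U, V⟩ h
    simp only [Finset.mem_sigma, Finset.mem_powerset] at h ⊢
    rw [Finset.union_sdiff_cancel_left
      (Finset.disjoint_of_subset_right h.2 Finset.disjoint_sdiff)]
  · rintro ⟨T, U⟩ h
    simp only [Finset.mem_sigma, Finset.mem_powerset] at h ⊢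
    rw [mul_assoc, sdiff_sdiff_left, Finset.sup_eq_union, Finset.union_sdiff_of_subset h.2]

theorem subsetConv_insert {R : Type*} [CommRing R] (f g : Finset ℕ → R) {S : Finset ℕ} {m : ℕ}
    (hm : m ∉ S) :
    subsetConv f g (insert m S) =
      subsetConv f (fun T => g (insert m T)) S + subsetConv (fun T => f (insert m T)) g S := by
  rw [subsetConv, Finset.sum_powerset_insert hm]
  congr 1 <;> refine Finset.sum_congr rfl fun T hT => ?_
  · rw [Finset.insert_sdiff_of_notMem _ fun h => hm (Finset.mem_powerset.1 hT h)]
  · rw [Finset.insert_sdiff_insert, Finset.sdiff_insert_of_notMem hm]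

theorem subsetConv_congr {R : Type*} [CommRing R] {f g f' g' : Finset ℕ → R} {S : Finset ℕ}
    (hf : ∀ T ⊆ S, f T = f' T) (hg : ∀ T ⊆ S, g T = g' T) :
    subsetConv f g S = subsetConv f' g' S :=
  Finset.sum_congr rfl fun T hT => by
    rw [hf T (Finset.mem_powerset.1 hT), hg _ Finset.sdiff_subset]

theorem subsetConv_mul_left {R : Type*} [CommRing R] (c : R) (f g : Finset ℕ → R) :
    subsetConv (fun T => c * f T) g = fun S => c * subsetConv f g S := by
  funext S
  simp only [subsetConv, Finset.mul_sum, mul_assoc]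

theorem subsetConv_add_left {R : Type*} [CommRing R] (f f' g : Finset ℕ → R) (S : Finset ℕ) :
    subsetConv (fun T => f T + f' T) g S = subsetConv f g S + subsetConv f' g S := by
  simp only [subsetConv, ← Finset.sum_add_distrib, add_mul]

/-- The number of descents of a word. -/
def wordDes : List ℕ → ℕ
  | [] => 0
  | [_] => 0
  | a :: b :: l => (if b < a then 1 else 0) + wordDes (b :: l)

/-- The number of right-to-left maxima of a word. -/
def wordRmax : List ℕ → ℕ
  | [] => 0
  | a :: l => (if ∀ b ∈ l, b < a then 1 else 0) + wordRmax l

/-- The number of left-to-right maxima of a word. -/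
def wordLmax (l : List ℕ) : ℕ := wordRmax l.reverse

/-- `0` for the empty word and `1` for any other word. -/
def wordNe (l : List ℕ) : ℕ := if l = [] then 0 else 1

theorem wordDes_append_cons (u v : List ℕ) (a : ℕ) :
    wordDes (u ++ a :: v) = wordDes (u ++ [a]) + wordDes (a :: v) := by
  induction u with
  | nil => simp [wordDes]
  | cons b u ih =>
    cases u with
    | nil => simp [wordDes]
    | cons c u =>
      simp only [List.cons_append, wordDes] at ih ⊢
      rw [ih, add_assoc]

theorem wordDes_append_max {u : List ℕ} {M : ℕ} (h : ∀ a ∈ u, a < M) :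
    wordDes (u ++ [M]) = wordDes u := by
  induction u with
  | nil => simp [wordDes]
  | cons b u ih =>
    cases u with
    | nil =>
      have := h b (by simp)
      simp [wordDes, this.le]
    | cons c u =>
      have := ih fun a ha => h a (List.mem_cons_of_mem _ ha)
      simp only [List.cons_append, wordDes] at this ⊢
      rw [this]

theorem wordDes_append_min {u : List ℕ} {m : ℕ} (h : ∀ a ∈ u, m < a) :
    wordDes (u ++ [m]) = wordDes u + wordNe u := by
  induction u with
  | nil => simp [wordDes, wordNe]
  | cons b u ih =>
    cases u with
    | nil =>
      have := h b (by simp)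
      simp [wordDes, this, wordNe]
    | cons c u =>
      have := ih fun a ha => h a (List.mem_cons_of_mem _ ha)
      simp only [List.cons_append, wordDes, wordNe, reduceCtorEq, if_false] at this ⊢
      rw [this, add_assoc]

theorem wordDes_max_cons {v : List ℕ} {M : ℕ} (h : ∀ a ∈ v, a < M) :
    wordDes (M :: v) = wordDes v + wordNe v := by
  cases v with
  | nil => simp [wordDes, wordNe]
  | cons b v => simp [wordDes, wordNe, h b (by simp), add_comm]

theorem wordDes_min_cons {v : List ℕ} {m : ℕ} (h : ∀ a ∈ v, m < a) :
    wordDes (m :: v) = wordDes v := by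
  cases v with
  | nil => simp [wordDes]
  | cons b v => simp [wordDes, (h b (by simp)).le]

theorem wordDes_max_split {u v : List ℕ} {M : ℕ} (h : ∀ a ∈ u ++ v, a < M) :
    wordDes (u ++ M :: v) = wordDes u + (wordDes v + wordNe v) := by
  rw [wordDes_append_cons, wordDes_append_max fun a ha => h a (by simp [ha]),
    wordDes_max_cons fun a ha => h a (by simp [ha])]

theorem wordDes_min_split {u v : List ℕ} {m : ℕ} (h : ∀ a ∈ u ++ v, m < a) :
    wordDes (u ++ m :: v) = wordDes u + wordNe u + wordDes v := by
  rw [wordDes_append_cons, wordDes_append_min fun a ha => h a (by simp [ha]),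
    wordDes_min_cons fun a ha => h a (by simp [ha])]

theorem wordRmax_max_split {u v : List ℕ} {M : ℕ} (h : ∀ a ∈ u ++ v, a < M) :
    wordRmax (u ++ M :: v) = wordRmax v + 1 := by
  induction u with
  | nil =>
    have : ∀ a ∈ v, a < M := by simpa using h
    simp only [List.nil_append, wordRmax, if_pos this, add_comm]
  | cons b u ih =>
    have : ¬ ∀ a ∈ u ++ M :: v, a < b := fun h' =>
      (h' M (by simp)).not_gt (h b (by simp))
    rw [List.cons_append, wordRmax, if_neg this, zero_add,
      ih fun a ha => h a (List.mem_cons_of_mem _ ha)]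

theorem wordLmax_max_split {u v : List ℕ} {M : ℕ} (h : ∀ a ∈ u ++ v, a < M) :
    wordLmax (u ++ M :: v) = wordLmax u + 1 := by
  have : (u ++ M :: v).reverse = v.reverse ++ M :: u.reverse := by simp
  rw [wordLmax, this, wordRmax_max_split, wordLmax]
  simpa [or_comm] using h

theorem wordNe_append_cons (u v : List ℕ) (a : ℕ) : wordNe (u ++ a :: v) = 1 := by
  simp [wordNe]

theorem forall_mem_append_of_wordsOn {S T : Finset ℕ} {u v : List ℕ} {p : ℕ → Prop}
    (hp : ∀ a ∈ S, p a) (hT : T ∈ S.powerset) (hu : u ∈ wordsOn T) (hv : v ∈ wordsOn (S \ T)) :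
    ∀ a ∈ u ++ v, p a := by
  intro a ha
  rcases List.mem_append.1 ha with h | h
  · exact hp a (Finset.mem_powerset.1 hT ((mem_of_mem_wordsOn hu).1 h))
  · exact hp a (Finset.mem_sdiff.1 ((mem_of_mem_wordsOn hv).1 h)).1

section Weights

variable {R : Type*} [CommRing R] (x a : R)

/-- The generating function of words by descents and left-to-right maxima. -/
def leftWeight (S : Finset ℕ) : R := ∑ w ∈ wordsOn S, x ^ wordDes w * a ^ wordLmax w

/-- The generating function of words by right-to-left maxima and by descents, counting an
additional descent in front of a nonempty word. -/
def rightWeight (S : Finset ℕ) : R :=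
  ∑ w ∈ wordsOn S, x ^ (wordDes w + wordNe w) * a ^ wordRmax w

/-- The generating function of pre-André words by descents and left-to-right maxima. -/
def andreWeight (S : Finset ℕ) : R :=
  ∑ w ∈ wordsOn S, if IsPreAndre1 w then x ^ wordDes w * a ^ wordLmax w else 0

/-- The generating function of André tails by descents, counting an additional descent in front of
a nonempty word. -/
def tailWeight (S : Finset ℕ) : R :=
  ∑ w ∈ wordsOn S, if IsAndreTail w then x ^ (wordDes w + wordNe w) else 0

/-- The generating function of the words with one additional maximal letter, by descents, and by
left-to-right and right-to-left maxima other than the maximal letter. -/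
def eulerWeight : Finset ℕ → R := subsetConv (leftWeight x a) (rightWeight x a)

variable {S : Finset ℕ}

theorem leftWeight_insert_max {M : ℕ} (hM : ∀ b ∈ S, b < M) :
    leftWeight x a (insert M S) = a * subsetConv (leftWeight x a) (rightWeight x 1) S := by
  rw [leftWeight, sum_wordsOn_insert fun h => (hM M h).false, subsetConv, Finset.mul_sum]
  refine Finset.sum_congr rfl fun T hT => ?_
  rw [leftWeight, rightWeight, Finset.sum_mul_sum, Finset.mul_sum]
  refine Finset.sum_congr rfl fun u hu => ?_
  rw [Finset.mul_sum]
  refine Finset.sum_congr rfl fun v hv => ?_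
  have h := forall_mem_append_of_wordsOn hM hT hu hv
  rw [wordDes_max_split h, wordLmax_max_split h]
  ring

theorem rightWeight_insert_max {M : ℕ} (hM : ∀ b ∈ S, b < M) :
    rightWeight x a (insert M S) = a * x * subsetConv (leftWeight x 1) (rightWeight x a) S := by
  rw [rightWeight, sum_wordsOn_insert fun h => (hM M h).false, subsetConv, Finset.mul_sum]
  refine Finset.sum_congr rfl fun T hT => ?_
  rw [leftWeight, rightWeight, Finset.sum_mul_sum, Finset.mul_sum]
  refine Finset.sum_congr rfl fun u hu => ?_
  rw [Finset.mul_sum]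
  refine Finset.sum_congr rfl fun v hv => ?_
  have h := forall_mem_append_of_wordsOn hM hT hu hv
  rw [wordDes_max_split h, wordRmax_max_split h, wordNe_append_cons]
  ring

theorem leftWeight_one_insert_min {m : ℕ} (hm : ∀ b ∈ S, m < b) :
    leftWeight x 1 (insert m S) = eulerWeight x 1 S := by
  rw [leftWeight, sum_wordsOn_insert fun h => (hm m h).false, eulerWeight, subsetConv_comm,
    subsetConv]
  refine Finset.sum_congr rfl fun T hT => ?_
  rw [leftWeight, rightWeight, Finset.sum_mul_sum]
  refine Finset.sum_congr rfl fun u hu => Finset.sum_congr rfl fun v hv => ?_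
  rw [wordDes_min_split (forall_mem_append_of_wordsOn hm hT hu hv)]
  ring

theorem rightWeight_one_of_nonempty (hS : S.Nonempty) :
    rightWeight x 1 S = x * leftWeight x 1 S := by
  rw [rightWeight, leftWeight, Finset.mul_sum]
  refine Finset.sum_congr rfl fun w hw => ?_
  obtain ⟨b, hb⟩ := hS
  have : w ≠ [] := List.ne_nil_of_mem ((mem_of_mem_wordsOn hw).2 hb)
  rw [wordNe, if_neg this]
  ring

theorem eulerWeight_empty : eulerWeight x a ∅ = 1 := by
  simp [eulerWeight, subsetConv, leftWeight, rightWeight, wordsOn_empty, wordDes, wordLmax,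
    wordRmax, wordNe]

theorem eulerWeight_insert_max {M : ℕ} (hM : ∀ b ∈ S, b < M) :
    eulerWeight x a (insert M S) =
      a * subsetConv (fun T => rightWeight x 1 T + x * leftWeight x 1 T) (eulerWeight x a) S := by
  have hM' : ∀ T ⊆ S, ∀ b ∈ T, b < M := fun T hT b hb => hM b (hT hb)
  rw [eulerWeight, subsetConv_insert _ _ fun h => (hM M h).false,
    subsetConv_congr (fun _ _ => rfl) fun T hT => rightWeight_insert_max x a (hM' T hT),
    subsetConv_congr (fun T hT => leftWeight_insert_max x a (hM' T hT)) fun _ _ => rfl,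
    subsetConv_mul_left, subsetConv_comm, subsetConv_mul_left, subsetConv_add_left,
    subsetConv_mul_left, subsetConv_comm (leftWeight x a) (rightWeight x 1),
    subsetConv_assoc, subsetConv_assoc,
    subsetConv_comm (rightWeight x a) (leftWeight x a)]
  ring

theorem rightWeight_add_leftWeight_empty :
    rightWeight x 1 ∅ + x * leftWeight x 1 ∅ = 1 + x := by
  simp [leftWeight, rightWeight, wordsOn_empty, wordDes, wordNe]

theorem rightWeight_add_leftWeight_insert_min {m : ℕ} (hm : ∀ b ∈ S, m < b) :
    rightWeight x 1 (insert m S) + x * leftWeight x 1 (insert m S) =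
      2 * x * eulerWeight x 1 S := by
  rw [rightWeight_one_of_nonempty x (Finset.insert_nonempty m S), leftWeight_one_insert_min x hm]
  ring

theorem andreWeight_empty : andreWeight x a ∅ = 1 := by
  simp [andreWeight, wordsOn_empty, wordDes, wordLmax, wordRmax, isPreAndre1_nil]

theorem andreWeight_insert_max {M : ℕ} (hM : ∀ b ∈ S, b < M) :
    andreWeight x a (insert M S) = a * subsetConv (tailWeight x) (andreWeight x a) S := by
  have hMS : M ∉ S := fun h => (hM M h).false
  rw [andreWeight, sum_wordsOn_insert hMS, subsetConv_comm, subsetConv, Finset.mul_sum]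
  refine Finset.sum_congr rfl fun T hT => ?_
  rw [andreWeight, tailWeight, Finset.sum_mul_sum, Finset.mul_sum]
  refine Finset.sum_congr rfl fun u hu => ?_
  rw [Finset.mul_sum]
  refine Finset.sum_congr rfl fun v hv => ?_
  have h := forall_mem_append_of_wordsOn hM hT hu hv
  have hnd := (mem_wordsOn.1 (append_cons_mem_wordsOn hMS (Finset.mem_powerset.1 hT) hu hv)).1
  rw [wordDes_max_split h, wordLmax_max_split h]
  by_cases h1 : IsPreAndre1 u <;> by_cases h2 : IsAndreTail v <;>
    simp only [isPreAndre1_max_split hnd h, h1, h2, and_self, and_true, and_false, if_true, if_false, mul_zero, zero_mul]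
  ring

theorem tailWeight_empty : tailWeight x ∅ = 1 := by
  simp [tailWeight, wordsOn_empty, wordDes, wordNe, IsAndreTail]

theorem tailWeight_insert_min {m : ℕ} (hm : ∀ b ∈ S, m < b) :
    tailWeight x (insert m S) = x * andreWeight x 1 S := by
  rw [tailWeight, sum_wordsOn_insert fun h => (hm m h).false,
    Finset.sum_eq_single_of_mem ∅ (Finset.empty_mem_powerset S), wordsOn_empty,
    Finset.sum_singleton, Finset.sdiff_empty, andreWeight, Finset.mul_sum]
  · refine Finset.sum_congr rfl fun v hv => ?_
    have h := forall_mem_append_of_wordsOn (u := []) hm (Finset.empty_mem_powerset S)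
      (by simp [wordsOn_empty]) (by simpa using hv)
    rw [wordDes_min_split h, wordNe_append_cons]
    have h' : IsAndreTail ([] ++ m :: v) ↔ IsPreAndre1 v := by
      rw [isAndreTail_min_split h, and_iff_right rfl]
    simp only [h', wordDes, wordNe, if_true, mul_ite, mul_zero]
    refine if_congr Iff.rfl ?_ rfl
    ring
  · intro T hT hne
    refine Finset.sum_eq_zero fun u hu => Finset.sum_eq_zero fun v hv => if_neg ?_
    rw [isAndreTail_min_split (forall_mem_append_of_wordsOn hm hT hu hv)]
    rintro ⟨rfl, -⟩
    exact hne (by simpa using (mem_wordsOn.1 hu).2.symm)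

end Weights

section Permutations

/-- The one-line notation of a permutation. -/
def permWord {n : ℕ} (σ : Equiv.Perm (Fin n)) : List ℕ :=
  List.ofFn fun i : Fin n => ((σ i : Fin n) : ℕ) + 1

theorem wrd_succ {n : ℕ} (σ : Equiv.Perm (Fin n)) (i : ℕ) :
    wrd σ (i + 1) = (permWord σ).getD i 0 := by
  by_cases h : i < n
  · rw [wrd, dif_pos ⟨by omega, by omega⟩, permWord, List.getD_eq_getElem _ _ (by simpa using h)]
    simp
  · rw [wrd, dif_neg (by omega), permWord, List.getD_eq_default _ _ (by simpa using h)]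

theorem length_permWord {n : ℕ} (σ : Equiv.Perm (Fin n)) : (permWord σ).length = n := by
  simp [permWord]

theorem wordDes_eq_card (l : List ℕ) :
    wordDes l = ((Finset.range (l.length - 1)).filter
      fun i => l.getD (i + 1) 0 < l.getD i 0).card := by
  induction l with
  | nil => simp [wordDes]
  | cons a l ih =>
    cases l with
    | nil => simp [wordDes]
    | cons b l =>
      rw [wordDes, ih, Finset.card_filter, Finset.card_filter]
      simp only [List.length_cons, Nat.add_sub_cancel]
      rw [Finset.sum_range_succ', add_comm]
      simp only [List.getD_cons_succ, List.getD_cons_zero]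

theorem forall_mem_iff_getD (l : List ℕ) (p : ℕ → Prop) :
    (∀ b ∈ l, p b) ↔ ∀ j < l.length, p (l.getD j 0) := by
  rw [List.forall_mem_iff_forall_getElem]
  refine forall₂_congr fun j hj => ?_
  rw [List.getD_eq_getElem _ _ hj]

theorem wordRmax_eq_card (l : List ℕ) :
    wordRmax l = ((Finset.range l.length).filter
      fun i => ∀ j ∈ Finset.Ico (i + 1) l.length, l.getD j 0 < l.getD i 0).card := by
  rw [Finset.card_filter]
  induction l with
  | nil => simp [wordRmax]
  | cons a l ih =>
    rw [wordRmax, ih, List.length_cons, Finset.sum_range_succ', add_comm]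
    congr 1
    · refine Finset.sum_congr rfl fun i _ => @if_congr _ _ _ (_) (_) _ _ _ _ ?_ rfl rfl
      simp only [Finset.mem_Ico, List.getD_cons_succ]
      refine ⟨fun h j hj => ?_, fun h j hj => ?_⟩
      · obtain ⟨k, rfl⟩ : ∃ k, j = k + 1 := ⟨j - 1, by omega⟩
        simpa using h k (by omega)
      · simpa using h (j + 1) (by omega)
    · refine @if_congr _ _ _ (_) (_) _ _ _ _ ?_ rfl rfl
      rw [forall_mem_iff_getD]
      simp only [Finset.mem_Ico, List.getD_cons_zero]
      refine ⟨fun h j hj => ?_, fun h j hj => ?_⟩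
      · obtain ⟨k, rfl⟩ : ∃ k, j = k + 1 := ⟨j - 1, by omega⟩
        simpa using h k (by omega)
      · simpa using h (j + 1) (by omega)

theorem wordLmax_eq_card (l : List ℕ) :
    wordLmax l = ((Finset.range l.length).filter
      fun i => ∀ j ∈ Finset.range i, l.getD j 0 < l.getD i 0).card := by
  induction l using List.reverseRecOn with
  | nil => simp [wordLmax, wordRmax]
  | append_singleton l a ih =>
    have h : wordLmax (l ++ [a]) = (if ∀ b ∈ l, b < a then 1 else 0) + wordLmax l := by
      simp [wordLmax, wordRmax]
    rw [h, ih, Finset.card_filter, Finset.card_filter, List.length_append, List.length_singleton,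
      Finset.sum_range_succ, add_comm]
    congr 1
    · refine Finset.sum_congr rfl fun i hi => if_congr (forall₂_congr fun j hj => ?_) rfl rfl
      simp only [Finset.mem_range] at hi hj
      rw [List.getD_append _ _ _ _ hi, List.getD_append _ _ _ _ (hj.trans hi)]
    · refine if_congr ?_ rfl rfl
      rw [forall_mem_iff_getD]
      simp only [Finset.mem_range]
      refine forall₂_congr fun j hj => ?_
      rw [List.getD_append _ _ _ _ hj, List.getD_append_right _ _ _ _ le_rfl]
      simp

theorem permDes_eq {n : ℕ} (σ : Equiv.Perm (Fin n)) : permDes σ = wordDes (permWord σ) := by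
  rw [permDes, wordDes_eq_card, length_permWord]
  refine Finset.card_nbij' (· - 1) (· + 1) ?_ ?_ ?_ ?_
  · intro i hi
    simp only [Finset.coe_filter, Finset.mem_Icc, Set.mem_ofPred_eq, Finset.mem_range] at hi ⊢
    obtain ⟨k, rfl⟩ : ∃ k, i = k + 1 := ⟨i - 1, by omega⟩
    rw [wrd_succ, wrd_succ] at hi
    exact ⟨by omega, hi.2⟩
  · intro i hi
    simp only [Finset.coe_filter, Finset.mem_Icc, Set.mem_ofPred_eq, Finset.mem_range] at hi ⊢
    rw [wrd_succ, wrd_succ]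
    exact ⟨by omega, hi.2⟩
  · intro i hi
    simp only [Finset.coe_filter, Finset.mem_Icc, Set.mem_ofPred_eq] at hi
    exact Nat.sub_add_cancel hi.1.1
  · intro i _
    exact Nat.add_sub_cancel i 1

theorem permLmax_eq {n : ℕ} (σ : Equiv.Perm (Fin n)) : permLmax σ = wordLmax (permWord σ) := by
  rw [permLmax, wordLmax_eq_card, length_permWord]
  have key (i : ℕ) : (∀ j ∈ Finset.Ico 1 (i + 1), wrd σ j < wrd σ (i + 1)) ↔
      ∀ j ∈ Finset.range i, (permWord σ).getD j 0 < (permWord σ).getD i 0 := by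
    simp only [Finset.mem_Ico, Finset.mem_range]
    refine ⟨fun h j hj => ?_, fun h j hj => ?_⟩
    · simpa only [wrd_succ] using h (j + 1) (by omega)
    · obtain ⟨k, rfl⟩ : ∃ k, j = k + 1 := ⟨j - 1, by omega⟩
      simpa only [wrd_succ] using h k (by omega)
  refine Finset.card_nbij' (· - 1) (· + 1) ?_ ?_ ?_ ?_
  · intro i hi
    simp only [Finset.coe_filter, Set.mem_ofPred_eq] at hi ⊢
    rw [Finset.mem_Icc] at hi
    obtain ⟨k, rfl⟩ : ∃ k, i = k + 1 := ⟨i - 1, by omega⟩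
    exact ⟨Finset.mem_range.2 (by omega), (key k).1 hi.2⟩
  · intro i hi
    simp only [Finset.coe_filter, Set.mem_ofPred_eq] at hi ⊢
    rw [Finset.mem_range] at hi
    exact ⟨Finset.mem_Icc.2 (by omega), (key i).2 hi.2⟩
  · intro i hi
    simp only [Finset.coe_filter, Finset.mem_Icc, Set.mem_ofPred_eq] at hi
    exact Nat.sub_add_cancel hi.1.1
  · intro i _
    exact Nat.add_sub_cancel i 1

theorem permRmax_eq {n : ℕ} (σ : Equiv.Perm (Fin n)) : permRmax σ = wordRmax (permWord σ) := by
  rw [permRmax, wordRmax_eq_card, length_permWord]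
  have key (i : ℕ) : (∀ j ∈ Finset.Icc (i + 1 + 1) n, wrd σ j < wrd σ (i + 1)) ↔
      ∀ j ∈ Finset.Ico (i + 1) n, (permWord σ).getD j 0 < (permWord σ).getD i 0 := by
    simp only [Finset.mem_Ico, Finset.mem_Icc]
    refine ⟨fun h j hj => ?_, fun h j hj => ?_⟩
    · simpa only [wrd_succ] using h (j + 1) (by omega)
    · obtain ⟨k, rfl⟩ : ∃ k, j = k + 1 := ⟨j - 1, by omega⟩
      simpa only [wrd_succ] using h k (by omega)
  refine Finset.card_nbij' (· - 1) (· + 1) ?_ ?_ ?_ ?_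
  · intro i hi
    simp only [Finset.coe_filter, Set.mem_ofPred_eq] at hi ⊢
    rw [Finset.mem_Icc] at hi
    obtain ⟨k, rfl⟩ : ∃ k, i = k + 1 := ⟨i - 1, by omega⟩
    exact ⟨Finset.mem_range.2 (by omega), (key k).1 hi.2⟩
  · intro i hi
    simp only [Finset.coe_filter, Set.mem_ofPred_eq] at hi ⊢
    rw [Finset.mem_range] at hi
    exact ⟨Finset.mem_Icc.2 (by omega), (key i).2 hi.2⟩
  · intro i hi
    simp only [Finset.coe_filter, Finset.mem_Icc, Set.mem_ofPred_eq] at hi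
    exact Nat.sub_add_cancel hi.1.1
  · intro i _
    exact Nat.add_sub_cancel i 1

theorem sum_perm_eq_sum_wordsOn {A : Type*} [AddCommMonoid A] (n : ℕ) (f : List ℕ → A) :
    ∑ σ : Equiv.Perm (Fin n), f (permWord σ) = ∑ w ∈ wordsOn (Finset.Icc 1 n), f w := by
  refine Finset.sum_nbij permWord ?_ ?_ ?_ (fun _ _ => rfl)
  · intro σ _
    rw [mem_wordsOn]
    refine ⟨List.nodup_ofFn.2 fun i j h => σ.injective (Fin.ext (Nat.succ_injective h)), ?_⟩
    ext a
    simp only [permWord, List.mem_toFinset, List.mem_ofFn', Set.mem_range, Finset.mem_Icc]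
    constructor
    · rintro ⟨i, rfl⟩
      omega
    · intro h
      exact ⟨σ.symm ⟨a - 1, by omega⟩, by simp; omega⟩
  · intro σ _ τ _ h
    have := List.ofFn_injective h
    ext i
    exact Nat.succ_injective (congrFun this i)
  · intro w hw
    obtain ⟨hnd, hS⟩ := mem_wordsOn.1 (Finset.mem_coe.1 hw)
    have hlen : w.length = n := by
      rw [← List.toFinset_card_of_nodup hnd, hS]
      simp
    subst hlen
    have hmem (i : Fin w.length) : 1 ≤ w[i] ∧ w[i] ≤ w.length := by
      rw [← Finset.mem_Icc, ← hS, List.mem_toFinset]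
      exact List.getElem_mem _
    let τ : Fin w.length → Fin w.length := fun i => ⟨w[i] - 1, by have := hmem i; omega⟩
    have hτ : Function.Injective τ := by
      intro i j h
      have h1 : w[i] - 1 = w[j] - 1 := congrArg Fin.val h
      have := hmem i
      have := hmem j
      exact Fin.ext ((hnd.getElem_inj_iff (hi := i.2) (hj := j.2)).1 (by
        simp only [Fin.getElem_fin] at *; omega))
    refine ⟨Equiv.ofBijective τ (Finite.injective_iff_bijective.1 hτ), by simp, ?_⟩
    rw [permWord]
    refine Eq.trans ?_ List.ofFn_getElem
    congr 1
    funext i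
    have := hmem i
    simp only [Fin.getElem_fin] at this
    simp only [Equiv.ofBijective_apply, τ, Fin.getElem_fin]
    omega

end Permutations

section GammaExpansion

/-- The span, over the coefficient ring, of the pairs
`(X ^ j, 2 ^ j * X ^ j * (1 + X) ^ (n - 2 * j))` with `2 * j ≤ n`. -/
def gammaPairs (n : ℕ) : Submodule ℚ[X] (ℚ[X][X] × ℚ[X][X]) :=
  Submodule.span ℚ[X] (Set.range fun j : Fin (n / 2 + 1) =>
    ((X : ℚ[X][X]) ^ (j : ℕ), C (2 ^ (j : ℕ)) * X ^ (j : ℕ) * (1 + X) ^ (n - 2 * (j : ℕ))))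

theorem mem_gammaPairs {n j : ℕ} (h : 2 * j ≤ n) :
    ((X : ℚ[X][X]) ^ j, C (2 ^ j) * X ^ j * (1 + X) ^ (n - 2 * j)) ∈ gammaPairs n :=
  Submodule.subset_span ⟨⟨j, by omega⟩, rfl⟩

theorem mul_mem_gammaPairs {m n : ℕ} {p q : ℚ[X][X] × ℚ[X][X]} (hp : p ∈ gammaPairs m)
    (hq : q ∈ gammaPairs n) : p * q ∈ gammaPairs (m + n) := by
  have h := Submodule.mul_mem_mul hp hq
  rw [gammaPairs, gammaPairs, Submodule.span_mul_span] at h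
  refine Submodule.span_le.2 ?_ h
  rintro _ ⟨_, ⟨i, rfl⟩, _, ⟨j, rfl⟩, rfl⟩
  have hi : 2 * (i : ℕ) ≤ m := by omega
  have hj : 2 * (j : ℕ) ≤ n := by omega
  refine Set.mem_of_eq_of_mem ?_ (mem_gammaPairs (n := m + n) (j := i + j) (by omega))
  have e : m + n - 2 * ((i : ℕ) + j) = (m - 2 * i) + (n - 2 * j) := by omega
  simp only [Prod.mk_mul_mk, e, pow_add, map_mul]
  congr 1
  ring

theorem exists_insert_max {S : Finset ℕ} (hS : S.Nonempty) :
    ∃ M T, S = insert M T ∧ T.card + 1 = S.card ∧ ∀ b ∈ T, b < M :=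
  ⟨S.max' hS, S.erase (S.max' hS), (Finset.insert_erase (S.max'_mem hS)).symm,
    Finset.card_erase_add_one (S.max'_mem hS), fun _ hb => S.lt_max'_of_mem_erase_max' hS hb⟩

theorem exists_insert_min {S : Finset ℕ} (hS : S.Nonempty) :
    ∃ m T, S = insert m T ∧ T.card + 1 = S.card ∧ ∀ b ∈ T, m < b :=
  ⟨S.min' hS, S.erase (S.min' hS), (Finset.insert_erase (S.min'_mem hS)).symm,
    Finset.card_erase_add_one (S.min'_mem hS), fun _ hb => S.min'_lt_of_mem_erase_min' hS hb⟩

theorem andreWeight_eulerWeight_mem (S : Finset ℕ) (c : ℚ[X]) :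
    (andreWeight X (C c) S, eulerWeight X (C c) S) ∈ gammaPairs S.card := by
  induction hn : S.card using Nat.strong_induction_on generalizing S c with
  | _ n ih =>
    subst hn
    rcases S.eq_empty_or_nonempty with rfl | hS
    · rw [andreWeight_empty, eulerWeight_empty]
      simpa using mem_gammaPairs (n := 0) (j := 0) le_rfl
    obtain ⟨M, T, rfl, hcard, hM⟩ := exists_insert_max hS
    have htail : ∀ U : Finset ℕ, U.card ≤ T.card →
        (tailWeight X U, rightWeight X 1 U + X * leftWeight X 1 U) ∈ gammaPairs (U.card + 1) := by
      intro U hU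
      rcases U.eq_empty_or_nonempty with rfl | hne
      · rw [tailWeight_empty, rightWeight_add_leftWeight_empty]
        simpa using mem_gammaPairs (n := 1) (j := 0) (by omega)
      · obtain ⟨m, V, rfl, hV, hm⟩ := exists_insert_min hne
        rw [tailWeight_insert_min _ hm, rightWeight_add_leftWeight_insert_min _ hm]
        have h1 := ih V.card (by omega) V 1 rfl
        have h2 := mul_mem_gammaPairs (mem_gammaPairs (n := 2) (j := 1) le_rfl) h1
        rw [← hV, show V.card + 1 + 1 = 2 + V.card by ring]
        simpa [show (C 2 : ℚ[X][X]) = 2 from rfl] using h2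
    rw [andreWeight_insert_max _ _ hM, eulerWeight_insert_max _ _ hM, ← hcard]
    have hsum : (C c * subsetConv (tailWeight X) (andreWeight X (C c)) T,
        C c * subsetConv (fun T => rightWeight X 1 T + X * leftWeight X 1 T)
          (eulerWeight X (C c)) T) =
        c • ∑ U ∈ T.powerset, ((tailWeight X U, rightWeight X 1 U + X * leftWeight X 1 U) *
          (andreWeight X (C c) (T \ U), eulerWeight X (C c) (T \ U))) := by
      refine Prod.ext ?_ ?_
      · rw [Prod.smul_fst, Prod.fst_sum, smul_eq_C_mul]
        rfl
      · rw [Prod.smul_snd, Prod.snd_sum, smul_eq_C_mul]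
        rfl
    rw [hsum]
    refine Submodule.smul_mem _ _ (Submodule.sum_mem _ fun U hU => ?_)
    have hU' := Finset.mem_powerset.1 hU
    have hc := Finset.card_sdiff_add_card_eq_card hU'
    have h1 := ih (T \ U).card (by omega) (T \ U) c rfl
    have h2 := mul_mem_gammaPairs (htail U (Finset.card_le_card hU')) h1
    rwa [show U.card + 1 + (T \ U).card = T.card + 1 by omega] at h2

theorem exists_gamma_expansion (S : Finset ℕ) (c : ℚ[X]) :
    ∃ e : ℕ → ℚ[X],
      andreWeight X (C c) S = ∑ j ∈ Finset.range (S.card / 2 + 1), C (e j) * X ^ j ∧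
      eulerWeight X (C c) S = ∑ j ∈ Finset.range (S.card / 2 + 1),
        C (2 ^ j * e j) * X ^ j * (1 + X) ^ (S.card - 2 * j) := by
  obtain ⟨e, he⟩ := (Submodule.mem_span_range_iff_exists_fun _).1 (andreWeight_eulerWeight_mem S c)
  refine ⟨fun j => if h : j < S.card / 2 + 1 then e ⟨j, h⟩ else 0, ?_, ?_⟩
  · have h : _ = andreWeight X (C c) S := congrArg Prod.fst he
    rw [Prod.fst_sum] at h
    rw [Finset.sum_range, ← h]
    refine Finset.sum_congr rfl fun j _ => ?_
    simp only [Prod.smul_fst, smul_eq_C_mul, Fin.is_lt, dite_true, Fin.eta]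
  · have h : _ = eulerWeight X (C c) S := congrArg Prod.snd he
    rw [Prod.snd_sum] at h
    rw [Finset.sum_range, ← h]
    refine Finset.sum_congr rfl fun j _ => ?_
    simp only [Prod.smul_snd, smul_eq_C_mul, Fin.is_lt, dite_true, Fin.eta, map_mul]
    ring

theorem gamma_coefficients_unique {A : Type*} [CommRing A] {n : ℕ} {e f : ℕ → A}
    (h : ∑ j ∈ Finset.range (n / 2 + 1), C (e j) * X ^ j * (1 + X : A[X]) ^ (n - 2 * j) =
      ∑ j ∈ Finset.range (n / 2 + 1), C (f j) * X ^ j * (1 + X : A[X]) ^ (n - 2 * j)) :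
    ∀ j ∈ Finset.range (n / 2 + 1), e j = f j := by
  intro j
  induction j using Nat.strong_induction_on with
  | _ j ih =>
    intro hj
    have hcoeff (g : ℕ → A) (i : ℕ) : (C (g i) * X ^ i * (1 + X : A[X]) ^ (n - 2 * i)).coeff j =
        if i ≤ j then g i * ((1 + X : A[X]) ^ (n - 2 * i)).coeff (j - i) else 0 := by
      rw [mul_assoc, coeff_C_mul, coeff_X_pow_mul', mul_ite, mul_zero]
    have h' := congrArg (fun p => coeff p j) h
    simp only [finsetSum_coeff, hcoeff] at h'
    rw [← Finset.add_sum_erase _ _ hj, ← Finset.add_sum_erase _ _ hj,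
      Finset.sum_congr (g := fun i => if i ≤ j then
        f i * ((1 + X : A[X]) ^ (n - 2 * i)).coeff (j - i) else 0) rfl] at h'
    · have := add_right_cancel h'
      simpa [coeff_zero_eq_eval_zero] using this
    · intro i hi
      obtain ⟨hij, hi⟩ := Finset.mem_erase.1 hi
      split_ifs with hle
      · rw [ih i (lt_of_le_of_ne hle hij) hi]
      · rfl

end GammaExpansion

theorem isAndrePerm1_iff {n : ℕ} (σ : Equiv.Perm (Fin n)) :
    IsAndrePerm1 σ ↔ IsAndre1 (permWord σ) := Iff.rfl

theorem Icc_one_succ_eq_insert (n : ℕ) :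
    Finset.Icc 1 (n + 1) = insert (n + 1) (Finset.Icc 1 n) := by
  ext a
  simp only [Finset.mem_Icc, Finset.mem_insert]
  omega

theorem lt_succ_of_mem_Icc_one {n : ℕ} : ∀ b ∈ Finset.Icc 1 n, b < n + 1 := fun b hb => by
  have := Finset.mem_Icc.1 hb
  omega

theorem wordDes_permWord_mem_range {n : ℕ} (σ : Equiv.Perm (Fin (n + 1))) :
    wordDes (permWord σ) ∈ Finset.range (n + 1) := by
  rw [Finset.mem_range, wordDes_eq_card, length_permWord]
  refine lt_of_le_of_lt (Finset.card_filter_le _ _) ?_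
  simp

theorem sum_Apoly_eq_eulerWeight (n : ℕ) :
    ∑ k ∈ Finset.range (n + 1), C (Apoly n k) * (X : ℚ[X][X]) ^ k =
      eulerWeight (X : ℚ[X][X]) (C X) (Finset.Icc 1 n) := by
  have h1 : ∑ k ∈ Finset.range (n + 1), C (Apoly n k) * (X : ℚ[X][X]) ^ k =
      ∑ σ : Equiv.Perm (Fin (n + 1)), (fun w => (X : ℚ[X][X]) ^ wordDes w *
        C X ^ (wordLmax w + wordRmax w - 2)) (permWord σ) := by
    rw [← Finset.sum_fiberwise_of_maps_to fun σ _ => wordDes_permWord_mem_range σ]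
    refine Finset.sum_congr rfl fun k _ => ?_
    rw [Apoly, map_sum, Finset.sum_mul]
    simp only [permDes_eq, permLmax_eq, permRmax_eq]
    refine Finset.sum_congr rfl fun σ hσ => ?_
    rw [(Finset.mem_filter.1 hσ).2, map_pow, mul_comm]
  rw [h1, sum_perm_eq_sum_wordsOn (n + 1) fun w => (X : ℚ[X][X]) ^ wordDes w *
      C X ^ (wordLmax w + wordRmax w - 2), Icc_one_succ_eq_insert,
    sum_wordsOn_insert (fun h => (lt_succ_of_mem_Icc_one _ h).false), eulerWeight, subsetConv]
  refine Finset.sum_congr rfl fun T hT => ?_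
  rw [leftWeight, rightWeight, Finset.sum_mul_sum]
  refine Finset.sum_congr rfl fun u hu => Finset.sum_congr rfl fun v hv => ?_
  have h := forall_mem_append_of_wordsOn lt_succ_of_mem_Icc_one hT hu hv
  have e : wordLmax u + 1 + (wordRmax v + 1) - 2 = wordLmax u + wordRmax v := by omega
  rw [wordDes_max_split h, wordLmax_max_split h, wordRmax_max_split h, e]
  ring

theorem sum_andrePerm_eq_andreWeight (n : ℕ) :
    ∑ σ ∈ Finset.univ.filter (fun σ : Equiv.Perm (Fin (n + 1)) => IsAndrePerm1 σ),
      (X : ℚ[X][X]) ^ permDes σ * C ((X : ℚ[X]) ^ (permLmax σ - 1)) =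
      andreWeight (X : ℚ[X][X]) (C X) (Finset.Icc 1 n) := by
  have hn : n + 1 ∉ Finset.Icc 1 n := fun h => (lt_succ_of_mem_Icc_one _ h).false
  rw [Finset.sum_filter]
  simp only [isAndrePerm1_iff, permDes_eq, permLmax_eq]
  rw [sum_perm_eq_sum_wordsOn (n + 1) fun w => if IsAndre1 w then
      (X : ℚ[X][X]) ^ wordDes w * C ((X : ℚ[X]) ^ (wordLmax w - 1)) else 0,
    Icc_one_succ_eq_insert, sum_wordsOn_insert hn, andreWeight,
    Finset.sum_eq_single_of_mem (Finset.Icc 1 n) (by simp)]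
  · refine Finset.sum_congr rfl fun u hu => ?_
    have hT : Finset.Icc 1 n ∈ (Finset.Icc 1 n).powerset := by simp
    have hv : [] ∈ wordsOn (Finset.Icc 1 n \ Finset.Icc 1 n) := by simp [wordsOn_empty]
    have h := forall_mem_append_of_wordsOn lt_succ_of_mem_Icc_one hT hu hv
    have hnd := (mem_wordsOn.1 (append_cons_mem_wordsOn hn subset_rfl hu hv)).1
    rw [Finset.sdiff_self, wordsOn_empty, Finset.sum_singleton, wordDes_max_split h,
      wordLmax_max_split h]
    refine if_congr (by simp [isAndre1_max_split hnd h]) ?_ rfl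
    simp [wordDes, wordNe]
  · intro T hT hne
    refine Finset.sum_eq_zero fun u hu => Finset.sum_eq_zero fun v hv => if_neg ?_
    have hT' := Finset.mem_powerset.1 hT
    rw [isAndre1_max_split (mem_wordsOn.1 (append_cons_mem_wordsOn hn hT' hu hv)).1
      (forall_mem_append_of_wordsOn lt_succ_of_mem_Icc_one hT hu hv)]
    rintro ⟨rfl, -⟩
    refine hne (hT'.antisymm (Finset.sdiff_eq_empty_iff_subset.1 ?_))
    simpa using (mem_wordsOn.1 hv).2.symm

/-- If γ_{n,j}(α) are the gamma-coefficients of the α-Eulerian polynomial and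
d_{n,j}(α) = γ_{n,j}(α)/2^j, then
Σ_j d_{n,j}(α) x^j = Σ_{σ ∈ A_{n+1}^1} x^{des σ} α^{lmax σ − 1}. -/
theorem d_coefficients_andre (γ d : ℕ → ℕ → Polynomial ℚ)
    (hγ : ∀ n : ℕ,
      (∑ k ∈ Finset.range (n + 1), Polynomial.C (Apoly n k) * Polynomial.X ^ k) =
        ∑ j ∈ Finset.range (n / 2 + 1),
          Polynomial.C (γ n j) * Polynomial.X ^ j *
            (1 + Polynomial.X : Polynomial (Polynomial ℚ)) ^ (n - 2 * j))
    (hd : ∀ n j : ℕ, (2 : Polynomial ℚ) ^ j * d n j = γ n j) :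
    ∀ n : ℕ,
      (∑ j ∈ Finset.range (n / 2 + 1), Polynomial.C (d n j) * Polynomial.X ^ j) =
        ∑ σ ∈ Finset.univ.filter (fun σ : Equiv.Perm (Fin (n + 1)) => IsAndrePerm1 σ),
          (Polynomial.X : Polynomial (Polynomial ℚ)) ^ permDes σ *
            Polynomial.C ((Polynomial.X : Polynomial ℚ) ^ (permLmax σ - 1)) := by
  intro n
  obtain ⟨e, he1, he2⟩ := exists_gamma_expansion (Finset.Icc 1 n) X
  rw [Nat.card_Icc, Nat.add_sub_cancel] at he1 he2
  rw [sum_andrePerm_eq_andreWeight, he1]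
  have h := gamma_coefficients_unique ((hγ n).symm.trans ((sum_Apoly_eq_eulerWeight n).trans he2))
  refine Finset.sum_congr rfl fun j hj => ?_
  have h2 : (2 : ℚ[X]) ^ j ≠ 0 := pow_ne_zero _ two_ne_zero
  rw [mul_left_cancel₀ h2 ((hd n j).trans (h j hj))]
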